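/- If G is a graph with no induced subgraph isomorphic to K_{1,3}, to H1, or to H2, then χ(G) ≤ ω(G) + 1. -/

import Mathlib

open SimpleGraph

def claw : SimpleGraph (Fin 1 ⊕ Fin 3) := completeBipartiteGraph (Fin 1) (Fin 3)

/-- `H1`: the path a-b-c-d-e together with chords ac and bd. -/
def H1 : SimpleGraph (Fin 5) :=
  fromEdgeSet {s(0, 1), s(1, 2), s(2, 3), s(3, 4), s(0, 2), s(1, 3)}

/-- `H2`: the 5-cycle a-b-c-d-e-a together with chords ac and bd. -/
def H2 : SimpleGraph (Fin 5) :=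
  fromEdgeSet {s(0, 1), s(1, 2), s(2, 3), s(3, 4), s(4, 0), s(0, 2), s(1, 3)}

theorem SimpleGraph.not_three_ends {V : Type*} [Finite V] (J : SimpleGraph V)
    (h2 : ∀ v x y z, J.Adj v x → J.Adj v y → J.Adj v z → x = y ∨ x = z ∨ y = z)
    {p q r : V} (hpq : p ≠ q) (hpr : p ≠ r) (hqr : q ≠ r)
    (hp : ∀ x y, J.Adj p x → J.Adj p y → x = y) (hq : ∀ x y, J.Adj q x → J.Adj q y → x = y)
    (hr : ∀ x y, J.Adj r x → J.Adj r y → x = y)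
    (rq : J.Reachable p q) (rr : J.Reachable p r) : False := by
  classical
  have := Fintype.ofFinite V
  let K := J.connectedComponentMk p
  have hmem : ∀ x, J.Reachable p x → x ∈ K.supp := fun x hx =>
    ConnectedComponent.sound hx.symm
  let P : K.supp := ⟨p, hmem p (Reachable.refl p)⟩
  let Q : K.supp := ⟨q, hmem q rq⟩
  let R : K.supp := ⟨r, hmem r rr⟩
  let J' : SimpleGraph K.supp := J.induce K.supp
  have hconn : J'.Connected := K.connected_toSimpleGraph
  have hedge := hconn.card_vert_le_card_edgeSet_add_one
  have hsum := J'.sum_degrees_eq_twice_card_edges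
  have hdeg : ∀ v : K.supp, J'.degree v ≤ 2 := by
    intro v
    by_contra! h
    rw [← card_neighborFinset_eq_degree, Finset.two_lt_card] at h
    obtain ⟨x, hx, y, hy, z, hz, hxy, hxz, hyz⟩ := h
    rw [mem_neighborFinset] at hx hy hz
    rcases h2 v x y z hx hy hz with h | h | h
    · exact hxy (Subtype.ext h)
    · exact hxz (Subtype.ext h)
    · exact hyz (Subtype.ext h)
  have hend : ∀ v : K.supp, (∀ x y, J.Adj v x → J.Adj v y → x = y) → J'.degree v ≤ 1 := by
    intro v hv
    rw [← card_neighborFinset_eq_degree, Finset.card_le_one]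
    intro x hx y hy
    rw [mem_neighborFinset] at hx hy
    exact Subtype.ext (hv x y hx hy)
  have hPQ : P ≠ Q := fun h => hpq (congrArg Subtype.val h)
  have hPR : P ≠ R := fun h => hpr (congrArg Subtype.val h)
  have hQR : Q ≠ R := fun h => hqr (congrArg Subtype.val h)
  have hle : ∑ v, (J'.degree v + if v ∈ ({P, Q, R} : Finset K.supp) then 1 else 0)
      ≤ ∑ v : K.supp, 2 := by
    refine Finset.sum_le_sum fun v _ => ?_
    split_ifs with h
    · simp only [Finset.mem_insert, Finset.mem_singleton] at h
      rcases h with rfl | rfl | rfl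
      · exact Nat.succ_le_succ (hend _ hp)
      · exact Nat.succ_le_succ (hend _ hq)
      · exact Nat.succ_le_succ (hend _ hr)
    · exact hdeg v
  rw [Finset.sum_add_distrib, hsum, Finset.sum_ite_mem, Finset.univ_inter,
    Finset.sum_const, Finset.sum_const, Finset.card_univ,
    Finset.card_eq_three.2 ⟨P, Q, R, hPQ, hPR, hQR, rfl⟩] at hle
  rw [Nat.card_eq_fintype_card, Nat.card_eq_fintype_card, ← edgeFinset_card] at hedge
  simp only [smul_eq_mul] at hle
  omega

/-- Recolouring along a component of the subgraph spanned by two colours. -/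
theorem SimpleGraph.exists_kempe_flip {V ι : Type*} [Finite V] [DecidableEq ι] (F : SimpleGraph V)
    (K : ι → Set V)
    (hclaw : ∀ v x y z, F.Adj v x → F.Adj v y → F.Adj v z → x ≠ y → x ≠ z → y ≠ z →
      F.Adj x y ∨ F.Adj x z ∨ F.Adj y z)
    (hK : ∀ q, F.IsClique (K q)) (hdisj : ∀ q q' x, x ∈ K q → x ∈ K q' → q = q')
    (hout : ∀ q x y z, x ∈ K q → F.Adj x y → F.Adj x z → y ∉ K q → z ∉ K q → y ≠ z → F.Adj y z)
    (N : Finset ι) (c : V → ℕ) (hc : ∀ x y, F.Adj x y → c x ≠ c y) (M : ι → Finset ℕ)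
    (hM : ∀ q ∈ N, ∀ x ∈ K q, c x ∉ M q) {i j : ℕ} (hij : i ≠ j)
    (hlt : (N.filter fun q => j ∈ M q).card < (N.filter fun q => i ∈ M q).card) :
    ∃ (c' : V → ℕ) (T : Finset ι), (∀ x y, F.Adj x y → c' x ≠ c' y) ∧
      (∀ x, c' x = c x ∨ c' x = Equiv.swap i j (c x)) ∧ T ⊆ N ∧
      (∀ q ∈ T, ∀ x ∈ K q, Equiv.swap i j (c' x) ∉ M q) ∧
      (∀ q ∈ N, q ∉ T → ∀ x ∈ K q, c' x ∉ M q) ∧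
      (∀ q ∈ T, j ∈ M q → i ∈ M q) ∧
      (T.filter fun q => i ∈ M q ∧ j ∉ M q).Nonempty ∧
      (T.filter fun q => i ∈ M q ∧ j ∉ M q).card ≤ 2 := by
  classical
  set A := N.filter fun q => i ∈ M q ∧ j ∉ M q with hA
  set B := N.filter fun q => j ∈ M q ∧ i ∉ M q with hB
  have hAB : B.card < A.card := by
    have h1 : (N.filter fun q => i ∈ M q).card
        = (N.filter fun q => i ∈ M q ∧ j ∈ M q).card + A.card := by
      rw [hA, ← Finset.filter_filter, ← Finset.filter_filter,
        Finset.card_filter_add_card_filter_not]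
    have h2 : (N.filter fun q => j ∈ M q).card
        = (N.filter fun q => j ∈ M q ∧ i ∈ M q).card + B.card := by
      rw [hB, ← Finset.filter_filter, ← Finset.filter_filter,
        Finset.card_filter_add_card_filter_not]
    have h3 : (N.filter fun q => j ∈ M q ∧ i ∈ M q) = N.filter fun q => i ∈ M q ∧ j ∈ M q :=
      Finset.filter_congr fun _ _ => and_comm
    rw [h3] at h2
    omega
  by_cases hfree : ∃ q ∈ A, ∀ x ∈ K q, c x ≠ j
  · obtain ⟨q, hq, hx⟩ := hfree
    have hq' := hq
    rw [hA, Finset.mem_filter] at hq'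
    have hf : ({q} : Finset ι).filter (fun q => i ∈ M q ∧ j ∉ M q) = {q} :=
      Finset.filter_true_of_mem (by simpa using hq'.2)
    refine ⟨c, {q}, hc, fun x => Or.inl rfl, by simpa using hq'.1, ?_, fun p hp _ => hM p hp,
      ?_, ?_, ?_⟩
    · intro p hp x hxp
      obtain rfl := Finset.mem_singleton.1 hp
      have h1 := hM p hq'.1 x hxp
      have h2 := hx x hxp
      have h3 : c x ≠ i := fun h => h1 (h ▸ hq'.2.1)
      rwa [Equiv.swap_apply_of_ne_of_ne h3 h2]
    · intro p hp h
      obtain rfl := Finset.mem_singleton.1 hp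
      exact hq'.2.1
    · rw [hf]; simp
    · rw [hf]; simp
  push Not at hfree
  have : Nonempty V := by
    obtain ⟨q, hq⟩ := Finset.card_pos.1 (Nat.zero_lt_of_lt hAB)
    exact ⟨(hfree q hq).choose⟩
  choose! y hyK hyc using hfree
  let J : SimpleGraph V :=
    { Adj := fun x z => F.Adj x z ∧ (c x = i ∧ c z = j ∨ c x = j ∧ c z = i)
      symm := ⟨fun x z h => ⟨h.1.symm, by tauto⟩⟩
      loopless := ⟨fun x h => F.loopless.irrefl x h.1⟩ }
  have hJ2 : ∀ v x y z, J.Adj v x → J.Adj v y → J.Adj v z → x = y ∨ x = z ∨ y = z := by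
    rintro v x y z ⟨hx, hx'⟩ ⟨hy, hy'⟩ ⟨hz, hz'⟩
    by_contra! h
    have := hclaw v x y z hx hy hz h.1 h.2.1 h.2.2
    have h1 := hc x y
    have h2 := hc x z
    have h3 := hc y z
    grind
  have hend : ∀ q x, x ∈ K q → (∀ z ∈ K q, ¬ J.Adj x z) → ∀ z w, J.Adj x z → J.Adj x w → z = w := by
    intro q x hx hno z w hz hw
    by_contra hne
    refine hc z w (hout q x z w hx hz.1 hw.1 (fun h => hno z h hz) (fun h => hno w h hw) hne) ?_
    have := hz.2
    have := hw.2
    grind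
  have hendA : ∀ q ∈ A, ∀ z w, J.Adj (y q) z → J.Adj (y q) w → z = w := by
    intro q hq
    have hq' := hq
    rw [hA, Finset.mem_filter] at hq'
    refine hend q _ (hyK q hq) fun z hz h => hM q hq'.1 z hz ?_
    have h1 := h.2
    have h2 := hyc q hq
    have : c z = i := by grind
    exact this ▸ hq'.2.1
  have hendB : ∀ q ∈ B, ∀ x ∈ K q, c x = i → ∀ z w, J.Adj x z → J.Adj x w → z = w := by
    intro q hq x hx hxi
    rw [hB, Finset.mem_filter] at hq
    refine hend q _ hx fun z hz h => hM q hq.1 z hz ?_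
    have h1 := h.2
    have : c z = j := by grind
    exact this ▸ hq.2.1
  obtain ⟨q, hqA, hq⟩ : ∃ q ∈ A, ∀ p ∈ B, ∀ x ∈ K p, c x = i → ¬ J.Reachable (y q) x := by
    by_contra! hcon
    choose! f hfB x hxK hxi hxr using hcon
    refine absurd (Finset.card_le_card_of_injOn f (fun q hq => hfB q hq) ?_) (not_le.2 hAB)
    intro p hp q hq hpq
    by_contra hne
    have hp : p ∈ A := hp
    have hq : q ∈ A := hq
    have hxx : x p = x q := by
      by_contra h
      exact hc _ _ (hK (f p) (hxK p hp) (hpq ▸ hxK q hq) h) ((hxi p hp).trans (hxi q hq).symm)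
    have hnx : ∀ p' ∈ A, ∀ q' ∈ A, y p' ≠ x q' := by
      intro p' hp' q' hq' h
      exact hij ((hxi q' hq').symm.trans (h ▸ hyc p' hp'))
    refine J.not_three_ends hJ2 (hnx p hp p hp) (p := y p) (q := x p) (r := y q) ?_ ?_
      (hendA p hp) (hendB (f p) (hfB p hp) _ (hxK p hp) (hxi p hp)) (hendA q hq) (hxr p hp) ?_
    · exact fun h => hne (hdisj p q _ (hyK p hp) (h ▸ hyK q hq))
    · exact (hnx q hq p hp).symm
    · exact (hxr p hp).trans (hxx ▸ (hxr q hq).symm)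
  have hPc : ∀ x, J.Reachable (y q) x → c x = i ∨ c x = j := by
    intro x hx
    obtain ⟨w⟩ := hx.symm
    cases w with
    | nil => exact Or.inr (hyc q hqA)
    | cons h _ => have := h.2; tauto
  have hPadj : ∀ x z, J.Reachable (y q) x → F.Adj x z → (c z = i ∨ c z = j) →
      J.Reachable (y q) z := by
    intro x z hx hxz hz
    refine hx.trans (Adj.reachable ⟨hxz, ?_⟩)
    have := hPc x hx
    have := hc x z hxz
    grind
  have hTA : ∀ p ∈ A, ∀ x ∈ K p, J.Reachable (y q) x → J.Reachable (y q) (y p) := by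
    intro p hp x hx hr
    by_cases h : x = y p
    · exact h ▸ hr
    · exact hPadj x _ hr (hK p hx (hyK p hp) h) (Or.inr (hyc p hp))
  refine ⟨fun x => if J.Reachable (y q) x then Equiv.swap i j (c x) else c x,
    N.filter fun p => ∃ x ∈ K p, J.Reachable (y q) x, ?_, ?_, Finset.filter_subset _ _, ?_, ?_, ?_,
    ?_, ?_⟩
  · have key : ∀ x z, F.Adj x z → J.Reachable (y q) x → ¬ J.Reachable (y q) z →
        Equiv.swap i j (c x) ≠ c z := by
      intro x z hxz hx hz
      have h1 : ¬ (c z = i ∨ c z = j) := fun h => hz (hPadj x z hx hxz h)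
      rcases hPc x hx with h | h <;> rw [h] <;> simp <;> tauto
    intro x z hxz
    dsimp only
    split_ifs with hx hz hz
    · exact fun h => hc x z hxz ((Equiv.swap i j).injective h)
    · exact key x z hxz hx hz
    · exact (key z x hxz.symm hz hx).symm
    · exact hc x z hxz
  · intro x
    dsimp only
    split_ifs <;> simp
  · intro p hp x hx
    rw [Finset.mem_filter] at hp
    obtain ⟨hpN, x0, hx0, hr⟩ := hp
    dsimp only
    split_ifs with h
    · simpa using hM p hpN x hx
    · have h1 : ¬ (c x = i ∨ c x = j) := by
        intro hcx
        refine h (hPadj x0 x hr (hK p hx0 hx ?_) hcx)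
        rintro rfl
        exact h hr
      push Not at h1
      rw [Equiv.swap_apply_of_ne_of_ne h1.1 h1.2]
      exact hM p hpN x hx
  · intro p hpN hp x hx
    have h : ¬ J.Reachable (y q) x := fun h => hp (Finset.mem_filter.2 ⟨hpN, x, hx, h⟩)
    simpa only [if_neg h] using hM p hpN x hx
  · intro p hp hj
    rw [Finset.mem_filter] at hp
    obtain ⟨hpN, x, hx, hr⟩ := hp
    by_contra hi
    refine hq p (by rw [hB, Finset.mem_filter]; exact ⟨hpN, hj, hi⟩) x hx ?_ hr
    refine (hPc x hr).resolve_right fun h => hM p hpN x hx (h ▸ hj)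
  · have hqA' := hqA
    rw [hA, Finset.mem_filter] at hqA'
    exact ⟨q, Finset.mem_filter.2 ⟨Finset.mem_filter.2 ⟨hqA'.1, y q, hyK q hqA, Reachable.refl _⟩,
      hqA'.2⟩⟩
  · by_contra! h
    rw [Finset.two_lt_card] at h
    obtain ⟨p1, h1, p2, h2, p3, h3, h12, h13, h23⟩ := h
    have hT : ∀ p ∈ (N.filter fun p => ∃ x ∈ K p, J.Reachable (y q) x).filter
        (fun q => i ∈ M q ∧ j ∉ M q), p ∈ A ∧ J.Reachable (y q) (y p) := by
      intro p hp
      rw [Finset.mem_filter, Finset.mem_filter] at hp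
      obtain ⟨⟨hpN, x, hx, hr⟩, hp⟩ := hp
      have : p ∈ A := by rw [hA, Finset.mem_filter]; exact ⟨hpN, hp⟩
      exact ⟨this, hTA p this x hx hr⟩
    obtain ⟨a1, r1⟩ := hT p1 h1
    obtain ⟨a2, r2⟩ := hT p2 h2
    obtain ⟨a3, r3⟩ := hT p3 h3
    have hne : ∀ p ∈ A, ∀ p' ∈ A, p ≠ p' → y p ≠ y p' := fun p hp p' hp' hpp h =>
      hpp (hdisj p p' _ (hyK p hp) (h ▸ hyK p' hp'))
    exact J.not_three_ends hJ2 (hne _ a1 _ a2 h12) (hne _ a1 _ a3 h13) (hne _ a2 _ a3 h23)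
      (hendA _ a1) (hendA _ a2) (hendA _ a3) (r1.symm.trans r2) (r1.symm.trans r3)

theorem SimpleGraph.colorable_of_nat {V : Type*} {G : SimpleGraph V} {k : ℕ} (c : V → ℕ)
    (hk : ∀ x, c x < k) (hc : ∀ x y, G.Adj x y → c x ≠ c y) : G.Colorable k :=
  ⟨Coloring.mk (fun x => (⟨c x, hk x⟩ : Fin k)) fun {x y} h he =>
    hc x y h (congrArg Fin.val he)⟩

theorem Finset.sum_sq_lt_of_transfer {α : Type*} (C : Finset α) {i j : α}
    (hi : i ∈ C) (hj : j ∈ C) (hij : i ≠ j) {f g : α → ℕ} (t : ℕ) (ht : 1 ≤ t) (ht2 : t ≤ 2)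
    (hfi : g i + t = f i) (hfj : g j = f j + t) (h : f j + 3 ≤ f i)
    (hfg : ∀ l ∈ C, l ≠ i → l ≠ j → g l = f l) : ∑ l ∈ C, g l ^ 2 < ∑ l ∈ C, f l ^ 2 := by
  classical
  have hj' : j ∈ C.erase i := Finset.mem_erase.2 ⟨hij.symm, hj⟩
  rw [← Finset.add_sum_erase C _ hi, ← Finset.add_sum_erase C (fun l => f l ^ 2) hi,
    ← Finset.add_sum_erase _ _ hj', ← Finset.add_sum_erase _ (fun l => f l ^ 2) hj',
    ← add_assoc, ← add_assoc]
  have hsum : ∑ l ∈ (C.erase i).erase j, g l ^ 2 = ∑ l ∈ (C.erase i).erase j, f l ^ 2 := by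
    refine Finset.sum_congr rfl fun l hl => ?_
    simp only [Finset.mem_erase] at hl
    rw [hfg l hl.2.2 hl.2.1 hl.1]
  rw [hsum, hfj, ← hfi]
  rw [← hfi] at h
  have : g i ^ 2 + (f j + t) ^ 2 < (g i + t) ^ 2 + f j ^ 2 := by
    have hlt : f j < g i := by omega
    nlinarith
  omega

/-- Given sets `M q` of colours missing on the cliques `K q`, one can recolour so that all
colours of `C` are missing about equally often. -/
theorem SimpleGraph.exists_balanced {V ι : Type*} [Finite V] [DecidableEq ι] (F : SimpleGraph V)
    (K : ι → Set V)
    (hclaw : ∀ v x y z, F.Adj v x → F.Adj v y → F.Adj v z → x ≠ y → x ≠ z → y ≠ z →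
      F.Adj x y ∨ F.Adj x z ∨ F.Adj y z)
    (hK : ∀ q, F.IsClique (K q)) (hdisj : ∀ q q' x, x ∈ K q → x ∈ K q' → q = q')
    (hout : ∀ q x y z, x ∈ K q → F.Adj x y → F.Adj x z → y ∉ K q → z ∉ K q → y ≠ z → F.Adj y z)
    (C : Finset ℕ) (N : Finset ι) (c : V → ℕ) (hc : ∀ x y, F.Adj x y → c x ≠ c y)
    (M : ι → Finset ℕ) (hMC : ∀ q ∈ N, M q ⊆ C) (hM : ∀ q ∈ N, ∀ x ∈ K q, c x ∉ M q) :
    ∃ (c' : V → ℕ) (M' : ι → Finset ℕ), (∀ x y, F.Adj x y → c' x ≠ c' y) ∧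
      (∀ x, c x ∉ C → c' x = c x) ∧ (∀ x, c x ∈ C → c' x ∈ C) ∧
      (∀ q ∈ N, M' q ⊆ C) ∧ (∀ q ∈ N, (M' q).card = (M q).card) ∧
      (∀ q ∈ N, ∀ x ∈ K q, c' x ∉ M' q) ∧
      ∀ i ∈ C, ∀ j ∈ C, (N.filter fun q => i ∈ M' q).card ≤ (N.filter fun q => j ∈ M' q).card + 2 := by
  classical
  induction hn : ∑ l ∈ C, (N.filter fun q => l ∈ M q).card ^ 2 using Nat.strong_induction_on
    generalizing c M with
  | _ n ih =>
  subst hn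
  by_cases hbal : ∀ i ∈ C, ∀ j ∈ C,
      (N.filter fun q => i ∈ M q).card ≤ (N.filter fun q => j ∈ M q).card + 2
  · exact ⟨c, M, hc, fun x _ => rfl, fun x h => h, hMC, fun q _ => rfl, hM, hbal⟩
  push Not at hbal
  obtain ⟨i, hi, j, hj, hlt⟩ := hbal
  have hij : i ≠ j := by
    rintro rfl
    omega
  obtain ⟨c₁, T, hc₁, hcc, hTN, hTM, hNM, hTij, hT1, hT2⟩ :=
    F.exists_kempe_flip K hclaw hK hdisj hout N c hc M hM hij (by omega)
  have hswap : ∀ l, Equiv.swap i j l ∈ C ↔ l ∈ C := by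
    intro l
    by_cases h1 : l = i
    · simp [h1, hi, hj]
    by_cases h2 : l = j
    · simp [h2, hi, hj]
    rw [Equiv.swap_apply_of_ne_of_ne h1 h2]
  let M₁ : ι → Finset ℕ := fun q =>
    if q ∈ T then (M q).map (Equiv.swap i j).toEmbedding else M q
  have hmem : ∀ q l, l ∈ M₁ q ↔ if q ∈ T then Equiv.swap i j l ∈ M q else l ∈ M q := by
    intro q l
    by_cases h : q ∈ T
    · simp only [M₁, if_pos h, Finset.mem_map_equiv, Equiv.symm_swap]
    · simp only [M₁, if_neg h]
  have hcard : ∀ q, (M₁ q).card = (M q).card := by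
    intro q
    simp only [M₁]
    split_ifs <;> simp
  have hM₁C : ∀ q ∈ N, M₁ q ⊆ C := by
    intro q hq l hl
    rw [hmem] at hl
    split_ifs at hl with h
    · exact (hswap l).1 (hMC q hq hl)
    · exact hMC q hq hl
  have hM₁ : ∀ q ∈ N, ∀ x ∈ K q, c₁ x ∉ M₁ q := by
    intro q hq x hx h
    rw [hmem] at h
    split_ifs at h with hT
    · exact hTM q hT x hx h
    · exact hNM q hq hT x hx h
  set A := T.filter fun q => i ∈ M q ∧ j ∉ M q with hA
  have hXi : (N.filter fun q => i ∈ M₁ q) = (N.filter fun q => i ∈ M q) \ A := by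
    ext q
    have := hTij q
    have := @hTN q
    simp only [hA, Finset.mem_filter, Finset.mem_sdiff, hmem, Equiv.swap_apply_left]
    split_ifs <;> tauto
  have hXj : (N.filter fun q => j ∈ M₁ q) = (N.filter fun q => j ∈ M q) ∪ A := by
    ext q
    have := hTij q
    have := @hTN q
    simp only [hA, Finset.mem_filter, Finset.mem_union, hmem, Equiv.swap_apply_right]
    split_ifs <;> tauto
  have hAi : A ⊆ N.filter fun q => i ∈ M q := by
    intro q hq
    rw [hA, Finset.mem_filter] at hq
    exact Finset.mem_filter.2 ⟨hTN hq.1, hq.2.1⟩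
  have hAj : Disjoint (N.filter fun q => j ∈ M q) A := by
    rw [Finset.disjoint_left]
    intro q hq hqA
    rw [hA, Finset.mem_filter] at hqA
    exact hqA.2.2 (Finset.mem_filter.1 hq).2
  have hdec : ∑ l ∈ C, (N.filter fun q => l ∈ M₁ q).card ^ 2
      < ∑ l ∈ C, (N.filter fun q => l ∈ M q).card ^ 2 := by
    refine C.sum_sq_lt_of_transfer hi hj hij A.card hT1.card_pos hT2 ?_ ?_ (by omega) ?_
    · rw [hXi, Finset.card_sdiff_add_card_eq_card hAi]
    · rw [hXj, Finset.card_union_of_disjoint hAj]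
    · intro l _ hli hlj
      congr 1
      ext q
      simp only [Finset.mem_filter, hmem, Equiv.swap_apply_of_ne_of_ne hli hlj, ite_self]
  obtain ⟨c', M', h1, h2, h3, h4, h5, h6, h7⟩ := ih _ hdec c₁ hc₁ M₁ hM₁C hM₁ rfl
  have hcC : ∀ x, c₁ x ∈ C ↔ c x ∈ C := by
    intro x
    rcases hcc x with h | h
    · rw [h]
    · rw [h, hswap]
  refine ⟨c', M', h1, fun x hx => ?_, fun x hx => h3 x ((hcC x).2 hx), h4,
    fun q hq => (h5 q hq).trans (hcard q), h6, h7⟩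
  rw [h2 x (fun h => hx ((hcC x).1 h))]
  rcases hcc x with h | h
  · exact h
  · rw [h, Equiv.swap_apply_of_ne_of_ne]
    · exact fun h => hx (h ▸ hi)
    · exact fun h => hx (h ▸ hj)

/-- If every clique `K q` misses two colours, with at most one exception that misses one, then one
can recolour so that the cliques miss pairwise distinct colours. -/
theorem SimpleGraph.exists_distinct_missing {V ι : Type*} [Finite V] [DecidableEq ι]
    (F : SimpleGraph V) (K : ι → Set V)
    (hclaw : ∀ v x y z, F.Adj v x → F.Adj v y → F.Adj v z → x ≠ y → x ≠ z → y ≠ z →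
      F.Adj x y ∨ F.Adj x z ∨ F.Adj y z)
    (hK : ∀ q, F.IsClique (K q)) (hdisj : ∀ q q' x, x ∈ K q → x ∈ K q' → q = q')
    (hout : ∀ q x y z, x ∈ K q → F.Adj x y → F.Adj x z → y ∉ K q → z ∉ K q → y ≠ z → F.Adj y z)
    (C : Finset ℕ) (N : Finset ι) (hNC : N.card ≤ C.card) (c : V → ℕ)
    (hc : ∀ x y, F.Adj x y → c x ≠ c y) (M : ι → Finset ℕ) (hMC : ∀ q ∈ N, M q ⊆ C)
    (hM : ∀ q ∈ N, ∀ x ∈ K q, c x ∉ M q) (u : ι) (hM1 : ∀ q ∈ N, 1 ≤ (M q).card)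
    (hM2 : ∀ q ∈ N, q ≠ u → 2 ≤ (M q).card) :
    ∃ (c' : V → ℕ) (r : ι → ℕ), (∀ x y, F.Adj x y → c' x ≠ c' y) ∧
      (∀ x, c x ∉ C → c' x = c x) ∧ (∀ x, c x ∈ C → c' x ∈ C) ∧ Set.InjOn r N ∧
      (∀ q ∈ N, r q ∈ C) ∧ ∀ q ∈ N, ∀ x ∈ K q, c' x ≠ r q := by
  classical
  induction hn : N.card generalizing N C c M u with
  | zero =>
    obtain rfl := Finset.card_eq_zero.1 hn
    exact ⟨c, fun _ => 0, hc, fun x _ => rfl, fun x h => h, by simp, by simp, by simp⟩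
  | succ n ih =>
  wlog hu : u ∈ N generalizing u
  · obtain ⟨v, hv⟩ := Finset.card_pos.1 (show 0 < N.card by omega)
    exact this v (fun q hq _ => hM2 q hq (by rintro rfl; exact hu hq)) hv
  have htrim : ∀ q, ∃ t : Finset ℕ, q ∈ N → t ⊆ M q ∧ t.card = if q = u then 1 else 2 := by
    intro q
    by_cases hq : q ∈ N
    · obtain ⟨t, ht⟩ := Finset.exists_subset_card_eq
        (show (if q = u then 1 else 2) ≤ (M q).card by
          split_ifs with h
          · exact hM1 q hq
          · exact hM2 q hq h)
      exact ⟨t, fun _ => ht⟩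
    · exact ⟨∅, fun h => absurd h hq⟩
  choose M₀ hM₀ using htrim
  obtain ⟨c₁, M₁, hc₁, hfix, hC, hM₁C, hcard, hM₁, hbal⟩ :=
    F.exists_balanced K hclaw hK hdisj hout C N c hc M₀
      (fun q hq => (hM₀ q hq).1.trans (hMC q hq))
      (fun q hq x hx h => hM q hq x hx ((hM₀ q hq).1 h))
  have hcard' : ∀ q ∈ N, (M₁ q).card = if q = u then 1 else 2 := fun q hq =>
    (hcard q hq).trans (hM₀ q hq).2
  have hsum : ∑ l ∈ C, (N.filter fun q => l ∈ M₁ q).card + 1 = 2 * N.card := by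
    have h1 : ∑ l ∈ C, (N.filter fun q => l ∈ M₁ q).card = ∑ q ∈ N, (M₁ q).card := by
      have := Finset.sum_card_bipartiteAbove_eq_sum_card_bipartiteBelow
        (s := C) (t := N) (fun l q => l ∈ M₁ q)
      simp only [Finset.bipartiteAbove, Finset.bipartiteBelow] at this
      rw [this]
      refine Finset.sum_congr rfl fun q hq => ?_
      rw [Finset.filter_mem_eq_inter, Finset.inter_eq_right.2 (hM₁C q hq)]
    rw [h1, Finset.sum_congr rfl hcard', ← Finset.add_sum_erase N _ hu, if_pos rfl,
      Finset.sum_congr rfl (g := fun _ => 2)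
        (fun q hq => if_neg (Finset.ne_of_mem_erase hq)), Finset.sum_const,
      Finset.card_erase_of_mem hu, smul_eq_mul]
    omega
  obtain ⟨l, hl, hl1⟩ : ∃ l ∈ C, (N.filter fun q => l ∈ M₁ q).card = 1 := by
    by_contra! hne
    have hodd : ∃ l ∈ C, ¬ 2 ∣ (N.filter fun q => l ∈ M₁ q).card := by
      by_contra! h
      have := Finset.dvd_sum h
      omega
    obtain ⟨l, hl, hlo⟩ := hodd
    have hl3 : 3 ≤ (N.filter fun q => l ∈ M₁ q).card := by
      have := hne l hl
      omega
    have hge : ∀ l' ∈ C, 2 ≤ (N.filter fun q => l' ∈ M₁ q).card := by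
      intro l' hl'
      have := hbal l hl l' hl'
      have := hne l' hl'
      omega
    have := Finset.sum_lt_sum hge ⟨l, hl, hl3⟩
    rw [Finset.sum_const, smul_eq_mul] at this
    omega
  obtain ⟨v, hv⟩ := Finset.card_eq_one.1 hl1
  have hvl : ∀ q ∈ N, l ∈ M₁ q → q = v := fun q hq h => by
    have : q ∈ N.filter fun q => l ∈ M₁ q := Finset.mem_filter.2 ⟨hq, h⟩
    rw [hv] at this
    exact Finset.mem_singleton.1 this
  have hvN : v ∈ N ∧ l ∈ M₁ v := by
    have : v ∈ N.filter fun q => l ∈ M₁ q := by rw [hv]; exact Finset.mem_singleton_self v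
    exact Finset.mem_filter.1 this
  have hsub : ∀ q ∈ N.erase v, q ∈ N := fun q hq => Finset.mem_of_mem_erase hq
  obtain ⟨c₂, r, hc₂, hfix₂, hC₂, hr, hrC, hrM⟩ := ih (C.erase l) (N.erase v)
    (by rw [Finset.card_erase_of_mem hl, Finset.card_erase_of_mem hvN.1]; omega) c₁ hc₁ M₁
    (fun q hq k hk => Finset.mem_erase.2 ⟨fun e => Finset.ne_of_mem_erase hq
      (hvl q (hsub q hq) (e ▸ hk)), hM₁C q (hsub q hq) hk⟩)
    (fun q hq => hM₁ q (hsub q hq)) u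
    (fun q hq => by rw [hcard' q (hsub q hq)]; split_ifs <;> omega)
    (fun q hq hqu => by rw [hcard' q (hsub q hq), if_neg hqu])
    (by rw [Finset.card_erase_of_mem hvN.1]; omega)
  refine ⟨c₂, Function.update r v l, hc₂, ?_, ?_, ?_, ?_, ?_⟩
  · intro x hx
    rw [hfix₂ x, hfix x hx]
    rw [hfix x hx]
    exact fun h => hx (Finset.mem_of_mem_erase h)
  · intro x hx
    by_cases h : c₁ x = l
    · rw [hfix₂ x (by simp [h]), h]
      exact hl
    · exact Finset.mem_of_mem_erase (hC₂ x (Finset.mem_erase.2 ⟨h, hC x hx⟩))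
  · intro p hp q hq hpq
    have hp : p ∈ N := hp
    have hq : q ∈ N := hq
    by_cases h1 : p = v <;> by_cases h2 : q = v
    · rw [h1, h2]
    · subst h1
      rw [Function.update_self, Function.update_of_ne h2] at hpq
      exact absurd hpq.symm (Finset.ne_of_mem_erase (hrC q (Finset.mem_erase.2 ⟨h2, hq⟩)))
    · subst h2
      rw [Function.update_self, Function.update_of_ne h1] at hpq
      exact absurd hpq (Finset.ne_of_mem_erase (hrC p (Finset.mem_erase.2 ⟨h1, hp⟩)))
    · rw [Function.update_of_ne h1, Function.update_of_ne h2] at hpq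
      exact hr (Finset.mem_coe.2 (Finset.mem_erase.2 ⟨h1, hp⟩))
        (Finset.mem_coe.2 (Finset.mem_erase.2 ⟨h2, hq⟩)) hpq
  · intro q hq
    by_cases h : q = v
    · rw [h, Function.update_self]
      exact hl
    · rw [Function.update_of_ne h]
      exact Finset.mem_of_mem_erase (hrC q (Finset.mem_erase.2 ⟨h, hq⟩))
  · intro q hq x hx
    by_cases h : q = v
    · subst h
      rw [Function.update_self]
      intro he
      by_cases h' : c₁ x ∈ C.erase l
      · exact Finset.ne_of_mem_erase (hC₂ x h') he
      · rw [hfix₂ x h'] at he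
        exact hM₁ q hq x hx (he ▸ hvN.2)
    · rw [Function.update_of_ne h]
      exact hrM q (Finset.mem_erase.2 ⟨h, hq⟩) x hx

/-- Extending a colouring to a maximum clique. -/
theorem SimpleGraph.colorable_of_induce_compl_clique {V : Type*} [Finite V] {G : SimpleGraph V}
    {k : ℕ}
    (hclaw : ∀ v x y z, G.Adj v x → G.Adj v y → G.Adj v z → x ≠ y → x ≠ z → y ≠ z →
      G.Adj x y ∨ G.Adj x z ∨ G.Adj y z)
    (hdia : ∀ b c a d, a ≠ d → G.Adj b c → G.Adj a b → G.Adj a c → G.Adj d b → G.Adj d c →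
      G.Adj a d)
    {Q : Finset V} (hQ : G.IsClique (Q : Set V)) (hQne : Q.Nonempty)
    (hmax : ∀ s : Finset V, G.IsClique (s : Set V) → s.card ≤ Q.card) (hQk : Q.card + 1 ≤ k)
    (hcol : (G.induce ((Q : Set V)ᶜ)).Colorable k) : G.Colorable k := by
  classical
  have := Fintype.ofFinite V
  obtain ⟨col⟩ := hcol
  have hout : ∀ x, x ∉ Q → ∀ p ∈ Q, ∀ q ∈ Q, p ≠ q → G.Adj x p → ¬ G.Adj x q := by
    intro x hx p hp q hq hpq hxp hxq
    have hall : ∀ s ∈ Q, G.Adj x s := by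
      intro s hs
      by_cases h1 : s = p
      · exact h1 ▸ hxp
      by_cases h2 : s = q
      · exact h2 ▸ hxq
      · exact hdia p q x s (by rintro rfl; exact hx hs) (hQ hp hq hpq) hxp hxq (hQ hs hp h1)
          (hQ hs hq h2)
    have := hmax (insert x Q) (by
      rw [Finset.coe_insert, isClique_insert]
      exact ⟨hQ, fun s hs _ => hall s hs⟩)
    rw [Finset.card_insert_of_notMem hx] at this
    omega
  have hnot : ∀ x, x ∉ Q → ∃ r ∈ Q, ¬ G.Adj x r := by
    intro x hx
    by_contra! hall
    have := hmax (insert x Q) (by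
      rw [Finset.coe_insert, isClique_insert]
      exact ⟨hQ, fun s hs _ => hall s hs⟩)
    rw [Finset.card_insert_of_notMem hx] at this
    omega
  let K : Q → Set ((Q : Set V)ᶜ : Set V) := fun q => {x | G.Adj q x}
  have hnmem : ∀ x : ((Q : Set V)ᶜ : Set V), (x : V) ∉ Q := fun x => x.2
  have hK : ∀ q, (G.induce ((Q : Set V)ᶜ)).IsClique (K q) := by
    intro q x hx y hy hxy
    have hx : G.Adj q x := hx
    have hy : G.Adj q y := hy
    show G.Adj x y
    have hxy' : (x : V) ≠ y := fun h => hxy (Subtype.ext h)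
    obtain ⟨r, hr, hxr⟩ := hnot x (hnmem x)
    have hqr : (q : V) ≠ r := fun h => hxr (h ▸ hx.symm)
    have hyr : ¬ G.Adj y r := hout y (hnmem y) q q.2 r hr hqr hy.symm
    have h1 : (x : V) ≠ r := fun h => hnmem x (h ▸ hr)
    have h2 : (y : V) ≠ r := fun h => hnmem y (h ▸ hr)
    have := hclaw q x y r hx hy (hQ q.2 hr hqr) hxy' h1 h2
    tauto
  have hKcard : ∀ q : Q, (K q).toFinset.card + 1 ≤ Q.card := by
    intro q
    have h1 := hmax (insert (q : V) ((K q).toFinset.map (Function.Embedding.subtype _))) (by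
      rw [Finset.coe_insert, isClique_insert]
      constructor
      · intro x hx y hy hxy
        simp only [Finset.coe_map, Set.mem_image, Set.coe_toFinset] at hx hy
        obtain ⟨x, hx, rfl⟩ := hx
        obtain ⟨y, hy, rfl⟩ := hy
        exact hK q hx hy (fun h => hxy (congrArg _ h))
      · intro x hx _
        simp only [Finset.coe_map, Set.mem_image, Set.coe_toFinset] at hx
        obtain ⟨x, hx, rfl⟩ := hx
        exact hx)
    rw [Finset.card_insert_of_notMem, Finset.card_map] at h1
    · exact h1
    · simp only [Finset.mem_map, not_exists, not_and]
      intro x _ h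
      have h : (x : V) = q := h
      exact hnmem x (by rw [h]; exact q.2)
  let M : Q → Finset ℕ := fun q =>
    Finset.range k \ (K q).toFinset.image fun x => (col x : ℕ)
  have hMcard : ∀ q, 2 ≤ (M q).card := by
    intro q
    have h1 := hKcard q
    have h2 : ((K q).toFinset.image fun x => (col x : ℕ)).card ≤ (K q).toFinset.card :=
      Finset.card_image_le
    have h3 := Finset.le_card_sdiff ((K q).toFinset.image fun x => (col x : ℕ)) (Finset.range k)
    rw [Finset.card_range] at h3
    simp only [M]
    omega
  obtain ⟨q₀, hq₀⟩ := hQne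
  obtain ⟨c, r, hc, -, hcC, hr, hrC, hrK⟩ :=
    (G.induce ((Q : Set V)ᶜ)).exists_distinct_missing K
      (fun v x y z hx hy hz hxy hxz hyz => hclaw v x y z hx hy hz (fun h => hxy (Subtype.ext h))
        (fun h => hxz (Subtype.ext h)) (fun h => hyz (Subtype.ext h))) hK
      (fun q q' x hx hx' => by
        by_contra hne
        exact hout x (hnmem x) q q.2 q' q'.2 (fun h => hne (Subtype.ext h))
          (show G.Adj q x from hx).symm (show G.Adj q' x from hx').symm)
      (fun q x y z hx hxy hxz hy hz hyz => by
        have hx : G.Adj q x := hx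
        have hxy : G.Adj x y := hxy
        have hxz : G.Adj x z := hxz
        have hy : ¬ G.Adj q y := hy
        have hz : ¬ G.Adj q z := hz
        have h1 : (q : V) ≠ y := fun h => hnmem y (h ▸ q.2)
        have h2 : (q : V) ≠ z := fun h => hnmem z (h ▸ q.2)
        have := hclaw x q y z hx.symm hxy hxz h1 h2 (fun h => hyz (Subtype.ext h))
        show G.Adj y z
        tauto)
      (Finset.range k) Finset.univ (by simp; omega) (fun x => (col x : ℕ))
      (fun x y hxy h => col.valid hxy (Fin.ext h)) M (fun q _ => Finset.sdiff_subset)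
      (fun q _ x hx h => (Finset.mem_sdiff.1 h).2
        (Finset.mem_image.2 ⟨x, Set.mem_toFinset.2 hx, rfl⟩)) ⟨q₀, hq₀⟩
      (fun q _ => one_le_two.trans (hMcard q)) (fun q _ _ => hMcard q)
  refine colorable_of_nat (fun v => if h : v ∈ Q then r ⟨v, h⟩ else c ⟨v, h⟩) (fun v => ?_)
    fun v w hvw => ?_
  · split_ifs with h
    · exact Finset.mem_range.1 (hrC _ (Finset.mem_univ _))
    · exact Finset.mem_range.1 (hcC _ (Finset.mem_range.2 (Fin.is_lt _)))
  · split_ifs with h1 h2 h2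
    · intro h
      exact hvw.ne (congrArg Subtype.val
        (hr (Finset.mem_coe.2 (Finset.mem_univ _)) (Finset.mem_coe.2 (Finset.mem_univ _)) h))
    · exact (hrK ⟨v, h1⟩ (Finset.mem_univ _) ⟨w, h2⟩ hvw).symm
    · exact hrK ⟨w, h2⟩ (Finset.mem_univ _) ⟨v, h1⟩ hvw.symm
    · exact hc ⟨v, h1⟩ ⟨w, h2⟩ hvw

/-- `b`, `c` are the vertices of degree three and `a`, `d` the vertices of degree two. -/
structure SimpleGraph.IsDiamond {V : Type*} (G : SimpleGraph V) (b c a d : V) : Prop where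
  ne : a ≠ d
  not_adj : ¬ G.Adj a d
  mid : G.Adj b c
  ab : G.Adj a b
  ac : G.Adj a c
  db : G.Adj d b
  dc : G.Adj d c

theorem SimpleGraph.IsDiamond.symm {V : Type*} {G : SimpleGraph V} {b c a d : V}
    (h : G.IsDiamond b c a d) : G.IsDiamond b c d a :=
  ⟨h.ne.symm, fun e => h.not_adj e.symm, h.mid, h.db, h.dc, h.ab, h.ac⟩

theorem SimpleGraph.IsDiamond.swap {V : Type*} {G : SimpleGraph V} {b c a d : V}
    (h : G.IsDiamond b c a d) : G.IsDiamond c b a d :=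
  ⟨h.ne, h.not_adj, h.mid.symm, h.ac, h.ab, h.dc, h.db⟩

theorem SimpleGraph.IsDiamond.adj_mid_of_adj {V : Type*} {G : SimpleGraph V}
    (hclaw : ∀ v x y z, G.Adj v x → G.Adj v y → G.Adj v z → x ≠ y → x ≠ z → y ≠ z →
      G.Adj x y ∨ G.Adj x z ∨ G.Adj y z)
    (hd : ∀ a b c d e, G.IsDiamond b c a d → G.Adj d e → G.Adj e b ∨ G.Adj e c)
    {b c a d : V} (h : G.IsDiamond b c a d) {x y : V} (hx : G.Adj x b ∨ G.Adj x c)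
    (hxy : G.Adj x y) : G.Adj y b ∨ G.Adj y c := by
  wlog hb : G.Adj x b generalizing b c
  · exact (this h.swap hx.symm (hx.resolve_left hb)).symm
  by_cases hxa : x = a
  · exact hd d b c a y h.symm (hxa ▸ hxy)
  by_cases hxd : x = d
  · exact hd a b c d y h (hxd ▸ hxy)
  have hcl := hclaw b x a d hb.symm h.ab.symm h.db.symm hxa hxd h.ne
  wlog ha : G.Adj x a generalizing a d
  · exact this h.symm hxd hxa (hclaw b x d a hb.symm h.db.symm h.ab.symm hxd hxa h.ne.symm)
      (by have := h.not_adj; tauto)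
  by_contra! hy
  have hya : ¬ G.Adj a y := fun e => by have := hd d b c a y h.symm e; tauto
  have hyd : ¬ G.Adj d y := fun e => by have := hd a b c d y h e; tauto
  have hyb : y ≠ b := fun e => hy.2 (e ▸ h.mid)
  have hyc : y ≠ c := fun e => hy.1 (e ▸ h.mid.symm)
  have hya' : y ≠ a := fun e => hy.1 (e ▸ h.ab)
  have hyd' : y ≠ d := fun e => hy.1 (e ▸ h.db)
  have hxd' : ¬ G.Adj x d := fun e => by
    have := hclaw x y a d hxy ha e hya' hyd' h.ne
    have := h.not_adj
    have := G.adj_comm y a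
    have := G.adj_comm y d
    tauto
  by_cases hxc : G.Adj x c
  · have := hd d b c x y ⟨Ne.symm hxd, fun e => hxd' e.symm, h.mid, h.db, h.dc, hb, hxc⟩ hxy
    tauto
  · have hne : c ≠ x := fun e => hxd' (e ▸ h.dc.symm)
    have := hd c a b x y ⟨hne, fun e => hxc e.symm, h.ab, h.ac.symm, h.mid.symm, ha, hb⟩ hxy
    have := G.adj_comm y a
    tauto

theorem SimpleGraph.IsDiamond.adj_tip_of_adj_mid {V : Type*} {G : SimpleGraph V}
    (hclaw : ∀ v x y z, G.Adj v x → G.Adj v y → G.Adj v z → x ≠ y → x ≠ z → y ≠ z →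
      G.Adj x y ∨ G.Adj x z ∨ G.Adj y z)
    {b c a d : V} (h : G.IsDiamond b c a d) {x : V} (hx : G.Adj x b ∨ G.Adj x c) :
    x = a ∨ x = d ∨ G.Adj x a ∨ G.Adj x d := by
  by_contra! hn
  rcases hx with hx | hx
  · have := hclaw b x a d hx.symm h.ab.symm h.db.symm hn.1 hn.2.1 h.ne
    have := h.not_adj
    tauto
  · have := hclaw c x a d hx.symm h.ac.symm h.dc.symm hn.1 hn.2.1 h.ne
    have := h.not_adj
    tauto

theorem SimpleGraph.colorable_of_two_cliques {V : Type*} [Finite V] {G : SimpleGraph V} {k : ℕ}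
    (hk : ∀ s : Finset V, G.IsClique s → s.card + 1 ≤ k) (X Y I : Set V) (hX : G.IsClique X)
    (hY : G.IsClique Y) (hI : ∀ x ∈ I, ∀ y ∈ I, ¬ G.Adj x y) (hV : ∀ v, v ∈ X ∨ v ∈ Y ∨ v ∈ I) :
    G.Colorable k := by
  classical
  have := Fintype.ofFinite V
  wlog hXY : Disjoint X Y generalizing Y
  · refine this (Y \ X) (hY.subset Set.sdiff_subset) (fun v => ?_) Set.disjoint_sdiff_right
    have := hV v
    simp only [Set.mem_sdiff]
    tauto
  have hYc := hk Y.toFinset (by simpa using hY)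
  rw [Set.toFinset_card] at hYc
  let R : X → Y ⊕ Fin (k - 1 - Fintype.card Y) → Prop :=
    fun x z => Sum.elim (fun y : Y => ¬ G.Adj x y) (fun _ => True) z
  obtain ⟨f, hf, hfR⟩ : ∃ f : X → Y ⊕ Fin (k - 1 - Fintype.card Y),
      Function.Injective f ∧ ∀ x, R x (f x) := by
    rw [← Fintype.all_card_le_filter_rel_iff_exists_injective]
    intro S
    rcases S.eq_empty_or_nonempty with rfl | ⟨s0, hs0⟩
    · simp
    have h1 := hk (S.map (Function.Embedding.subtype _) ∪
      ((Finset.univ : Finset Y).filter fun y : Y => ∀ x ∈ S, G.Adj x y).map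
        (Function.Embedding.subtype _)) (by
        intro u hu v hv huv
        simp only [Finset.coe_union, Finset.coe_map, Set.mem_union, Set.mem_image,
          Finset.mem_coe, Finset.mem_filter, Finset.mem_univ, true_and,
          Function.Embedding.subtype_apply] at hu hv
        rcases hu with ⟨u, hu, rfl⟩ | ⟨u, hu, rfl⟩ <;> rcases hv with ⟨v, hv, rfl⟩ | ⟨v, hv, rfl⟩
        · exact hX u.2 v.2 huv
        · exact hv u hu
        · exact (hu v hv).symm
        · exact hY u.2 v.2 huv)
    rw [Finset.card_union_of_disjoint, Finset.card_map, Finset.card_map] at h1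
    · have h2 : ((Finset.univ : Finset Y).filter fun y : Y => ¬ ∀ x ∈ S, G.Adj x y).disjSum
          (Finset.univ : Finset (Fin (k - 1 - Fintype.card Y))) ⊆
          Finset.univ.filter fun z : Y ⊕ Fin (k - 1 - Fintype.card Y) => ∃ x ∈ S, R x z := by
        intro z hz
        rw [Finset.mem_filter]
        refine ⟨Finset.mem_univ _, ?_⟩
        rcases z with y | z
        · simp only [Finset.inl_mem_disjSum, Finset.mem_filter, Finset.mem_univ, true_and] at hz
          push Not at hz
          exact hz
        · exact ⟨s0, hs0, trivial⟩
      have h3 := Finset.card_le_card h2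
      rw [Finset.card_disjSum, Finset.card_univ, Fintype.card_fin] at h3
      have h4 := Finset.card_filter_add_card_filter_not (s := (Finset.univ : Finset Y))
        (fun y : Y => ∀ x ∈ S, G.Adj x y)
      rw [Finset.card_univ] at h4
      have h5 : S.card ≤ (Finset.univ.filter fun z : Y ⊕ Fin (k - 1 - Fintype.card Y) =>
          ∃ x ∈ S, R x z).card := by omega
      convert h5
    · rw [Finset.disjoint_left]
      intro v hv hv'
      simp only [Finset.mem_map, Function.Embedding.subtype_apply] at hv hv'
      obtain ⟨u, -, rfl⟩ := hv
      obtain ⟨w, -, hw⟩ := hv'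
      exact Set.disjoint_left.1 hXY u.2 (hw ▸ w.2)
  let col : V → Option (Y ⊕ Fin (k - 1 - Fintype.card Y)) := fun v =>
    if hv : v ∈ X then some (f ⟨v, hv⟩) else if hv : v ∈ Y then some (Sum.inl ⟨v, hv⟩) else none
  have hXYc : ∀ u v (hu : u ∈ X) (hv : v ∈ Y), G.Adj u v → f ⟨u, hu⟩ ≠ Sum.inl ⟨v, hv⟩ := by
    intro u v hu hv huv he
    have := hfR ⟨u, hu⟩
    rw [he] at this
    exact this huv
  have hcol : ∀ u v, G.Adj u v → col u ≠ col v := by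
    intro u v huv
    simp only [col]
    split_ifs with h1 h2 h3 h3 h4 h5 h6 h7
    · intro h
      exact huv.ne (congrArg Subtype.val (hf (Option.some.inj h)))
    · exact fun h => hXYc u v h1 h3 huv (Option.some.inj h)
    · simp
    · exact fun h => hXYc v u h4 h3 huv.symm (Option.some.inj h).symm
    · intro h
      exact huv.ne (congrArg Subtype.val (Sum.inl_injective (Option.some.inj h)))
    · simp
    · simp
    · simp
    · have := hV u
      have := hV v
      exact absurd huv (hI u (by tauto) v (by tauto))
  have := (Coloring.mk col fun {u v} h => hcol u v h).colorable
  refine this.mono ?_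
  rw [Fintype.card_option, Fintype.card_sum, Fintype.card_fin]
  omega

theorem SimpleGraph.colorable_of_no_indep_triple {V : Type*} [Finite V] {G : SimpleGraph V} {k : ℕ}
    (hk : ∀ s : Finset V, G.IsClique s → s.card + 1 ≤ k)
    (hdom : ∀ b c a d x, G.IsDiamond b c a d → G.Adj x b ∨ G.Adj x c)
    (hα : ∀ x y z, x ≠ y → x ≠ z → y ≠ z → G.Adj x y ∨ G.Adj x z ∨ G.Adj y z)
    {a d : V} (had : a ≠ d) (hnad : ¬ G.Adj a d) : G.Colorable k := by
  classical
  obtain ⟨_⟩ : Nonempty (LinearOrder V) := ⟨linearOrderOfSTO WellOrderingRel⟩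
  have comm := G.adj_comm
  have irr := fun v => G.loopless.irrefl v
  let B : Set V := {t | G.Adj t a ∧ G.Adj t d}
  let U : Set V := {t | ∃ p, p ≠ t ∧ ¬ G.Adj p t ∧ p ∉ B ∧ p ≠ a ∧ p ≠ d}
  have hpath : ∀ u ∈ B, ∀ v ∈ B, ∀ w ∈ B, u ≠ v → v ≠ w → u ≠ w → ¬ G.Adj u v → G.Adj v w := by
    intro u hu v hv w hw huv hvw huw hnuv
    by_contra hnvw
    have hadj : G.Adj u w := by have := hα u v w huv huw hvw; tauto
    have := hdom u w a d v ⟨had, hnad, hadj, hu.1.symm, hw.1.symm, hu.2.symm, hw.2.symm⟩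
    have := comm u v
    tauto
  have hbad : ∀ a d t t' p q, a ≠ d → ¬ G.Adj a d → G.Adj t a → G.Adj t d → G.Adj t' a →
      G.Adj t' d → G.Adj t t' → p ≠ a → p ≠ d → ¬ G.Adj p a → ¬ G.Adj p t → q ≠ a →
      ¬ G.Adj q t' → (¬ G.Adj q a ∨ ¬ G.Adj q d) → p ≠ t → False := by
    intro a d t t' p q had hnad hta htd hta' htd' htt hpa hpd hnpa hnpt hqa hnqt hq hpt
    have hpd' : G.Adj p d := by have := hα p a d hpa hpd had; tauto
    have h1 := hdom t t' a d p ⟨had, hnad, htt, hta.symm, hta'.symm, htd.symm, htd'.symm⟩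
    have hpt' : G.Adj p t' := by tauto
    have h2 := hdom d t' p t q ⟨hpt, hnpt, htd'.symm, hpd', hpt', htd, htt⟩
    have hqd : G.Adj q d := by tauto
    have hpq : p ≠ q := by rintro rfl; exact hnqt hpt'
    have hpq' : G.Adj p q := by have := hα p q a hpq hpa hqa; tauto
    have h3 := hdom t t' a d q ⟨had, hnad, htt, hta.symm, hta'.symm, htd.symm, htd'.symm⟩
    have hqt : G.Adj q t := by tauto
    have h4 := hdom q d p t a ⟨hpt, hnpt, hqd, hpq', hpd', hqt.symm, htd⟩
    have := comm a q
    tauto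
  refine colorable_of_two_cliques hk
    ({x | x ≠ a ∧ ¬ G.Adj x a} ∪ {u | u ∈ B \ U ∧ ∃ v ∈ B, u < v ∧ ¬ G.Adj u v})
    ({x | x ≠ d ∧ ¬ G.Adj x d} ∪ {u | u ∈ B \ U ∧ ¬ ∃ v ∈ B, u < v ∧ ¬ G.Adj u v})
    (B ∩ U) ?_ ?_ ?_ ?_
  · rintro x (⟨hx, hxa⟩ | ⟨⟨hx, hxU⟩, x', hx', hlt, hn⟩) y
      (⟨hy, hya⟩ | ⟨⟨hy, hyU⟩, y', hy', hlt', hn'⟩) hxy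
    · have := hα x y a hxy hx hy
      tauto
    · by_contra h
      by_cases hxd : x = d
      · exact h (hxd ▸ hy.2.symm)
      · exact hyU ⟨x, hxy, h, fun hB => hxa hB.1, hx, hxd⟩
    · by_contra h
      by_cases hyd : y = d
      · exact h (hyd ▸ hx.2)
      · exact hxU ⟨y, hxy.symm, fun e => h e.symm, fun hB => hya hB.1, hy, hyd⟩
    · by_contra h
      rcases hxy.lt_or_gt with hl | hl
      · exact hn' (hpath x hx y hy y' hy' hxy hlt'.ne (hl.trans hlt').ne h)
      · exact hn (hpath y hy x hx x' hx' hxy.symm hlt.ne (hl.trans hlt).ne fun e => h e.symm)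
  · rintro x (⟨hx, hxa⟩ | ⟨⟨hx, hxU⟩, hx'⟩) y (⟨hy, hya⟩ | ⟨⟨hy, hyU⟩, hy'⟩) hxy
    · have := hα x y d hxy hx hy
      tauto
    · by_contra h
      by_cases hxd : x = a
      · exact h (hxd ▸ hy.1.symm)
      · exact hyU ⟨x, hxy, h, fun hB => hxa hB.2, hxd, hx⟩
    · by_contra h
      by_cases hyd : y = a
      · exact h (hyd ▸ hx.1)
      · exact hxU ⟨y, hxy.symm, fun e => h e.symm, fun hB => hya hB.2, hyd, hy⟩
    · by_contra h
      rcases hxy.lt_or_gt with hl | hl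
      · exact hx' ⟨y, hy, hl, h⟩
      · exact hy' ⟨x, hx, hl, fun e => h e.symm⟩
  · rintro t ⟨ht, p, hpt, hnpt, hpB, hpa, hpd⟩ t' ⟨ht', q, hqt, hnqt, hqB, hqa, hqd⟩ htt
    have hqB' : ¬ G.Adj q a ∨ ¬ G.Adj q d := not_and_or.1 hqB
    rcases not_and_or.1 hpB with h | h
    · exact hbad a d t t' p q had hnad ht.1 ht.2 ht'.1 ht'.2 htt hpa hpd h hnpt hqa hnqt hqB' hpt
    · exact hbad d a t t' p q had.symm (fun e => hnad e.symm) ht.2 ht.1 ht'.2 ht'.1 htt hpd hpa h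
        hnpt hqd hnqt hqB'.symm hpt
  · intro v
    by_cases h1 : v ≠ a ∧ ¬ G.Adj v a
    · exact Or.inl (Or.inl h1)
    by_cases h2 : v ≠ d ∧ ¬ G.Adj v d
    · exact Or.inr (Or.inl (Or.inl h2))
    have hvB : v ∈ B := by
      have hva : v ≠ a := by
        rintro rfl
        exact h2 ⟨had, hnad⟩
      have hvd : v ≠ d := by
        rintro rfl
        exact h1 ⟨had.symm, fun e => hnad e.symm⟩
      exact ⟨by tauto, by tauto⟩
    by_cases hU : v ∈ U
    · exact Or.inr (Or.inr ⟨hvB, hU⟩)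
    by_cases h3 : ∃ w ∈ B, v < w ∧ ¬ G.Adj v w
    · exact Or.inl (Or.inr ⟨⟨hvB, hU⟩, h3⟩)
    · exact Or.inr (Or.inl (Or.inr ⟨⟨hvB, hU⟩, h3⟩))

/-- A triangle `a b c` together with a vertex over each of its edges. -/
structure SimpleGraph.IsSun {V : Type*} (G : SimpleGraph V) (a b c a' b' c' : V) : Prop where
  ab : G.Adj a b
  ac : G.Adj a c
  bc : G.Adj b c
  ba' : G.Adj a' b
  ca' : G.Adj a' c
  ab' : G.Adj b' a
  cb' : G.Adj b' c
  ac' : G.Adj c' a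
  bc' : G.Adj c' b
  naa : ¬ G.Adj a' a
  nbb : ¬ G.Adj b' b
  ncc : ¬ G.Adj c' c
  nab : ¬ G.Adj a' b'
  nac : ¬ G.Adj a' c'
  nbc : ¬ G.Adj b' c'

theorem SimpleGraph.IsSun.rotate {V : Type*} {G : SimpleGraph V} {a b c a' b' c' : V}
    (h : G.IsSun a b c a' b' c') : G.IsSun b c a b' c' a' where
  ab := h.bc
  ac := h.ab.symm
  bc := h.ac.symm
  ba' := h.cb'
  ca' := h.ab'
  ab' := h.bc'
  cb' := h.ac'
  ac' := h.ba'
  bc' := h.ca'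
  naa := h.nbb
  nbb := h.ncc
  ncc := h.naa
  nab := h.nbc
  nac := fun e => h.nab e.symm
  nbc := fun e => h.nac e.symm

theorem SimpleGraph.IsDiamond.exists_isSun_of_tip {V : Type*} {G : SimpleGraph V}
    (hclaw : ∀ v x y z, G.Adj v x → G.Adj v y → G.Adj v z → x ≠ y → x ≠ z → y ≠ z →
      G.Adj x y ∨ G.Adj x z ∨ G.Adj y z)
    (hmid : ∀ b c a d x, G.IsDiamond b c a d → G.Adj x b ∨ G.Adj x c)
    (htip : ∀ b c a d x, G.IsDiamond b c a d → x = a ∨ x = d ∨ G.Adj x a ∨ G.Adj x d)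
    {b c a d x y : V} (h : G.IsDiamond b c a d) (hax : a ≠ x) (hay : a ≠ y) (hxy : x ≠ y)
    (nax : ¬ G.Adj a x) (nay : ¬ G.Adj a y) (nxy : ¬ G.Adj x y) :
    ∃ a b c a' b' c', G.IsSun a b c a' b' c' := by
  have comm := G.adj_comm
  have hxd : x ≠ d := by
    rintro rfl
    have := htip b c a x y h
    have := comm x y
    have := comm a y
    tauto
  have hyd : y ≠ d := by
    rintro rfl
    have := htip b c a y x h
    have := comm a x
    tauto
  have hdx : G.Adj x d := by
    have := htip b c a d x h
    have := comm a x
    tauto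
  have hdy : G.Adj y d := by
    have := htip b c a d y h
    have := comm a y
    tauto
  wlog hxb : G.Adj x b generalizing b c
  · exact this h.swap ((hmid b c a d x h).resolve_left hxb)
  have hyb : ¬ G.Adj y b := fun e => by
    have := hclaw b a x y h.ab.symm hxb.symm e.symm hax hay hxy
    tauto
  have hyc : G.Adj y c := (hmid b c a d y h).resolve_left hyb
  have hxc : ¬ G.Adj x c := fun e => by
    have := hclaw c a x y h.ac.symm e.symm hyc.symm hax hay hxy
    tauto
  exact ⟨d, b, c, a, y, x, h.db, h.dc, h.mid, h.ab, h.ac, hdy, hyc, hdx, hxb, h.not_adj,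
    hyb, hxc, nay, nax, fun e => nxy e.symm⟩

theorem SimpleGraph.IsDiamond.exists_isSun {V : Type*} {G : SimpleGraph V}
    (hclaw : ∀ v x y z, G.Adj v x → G.Adj v y → G.Adj v z → x ≠ y → x ≠ z → y ≠ z →
      G.Adj x y ∨ G.Adj x z ∨ G.Adj y z)
    (hmid : ∀ b c a d x, G.IsDiamond b c a d → G.Adj x b ∨ G.Adj x c)
    (htip : ∀ b c a d x, G.IsDiamond b c a d → x = a ∨ x = d ∨ G.Adj x a ∨ G.Adj x d)
    {b c a d x y z : V} (h : G.IsDiamond b c a d) (hxy : x ≠ y) (hxz : x ≠ z) (hyz : y ≠ z)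
    (nxy : ¬ G.Adj x y) (nxz : ¬ G.Adj x z) (nyz : ¬ G.Adj y z) :
    ∃ a b c a' b' c', G.IsSun a b c a' b' c' := by
  have comm := G.adj_comm
  have tip : ∀ {x y z b c d}, x ≠ y → x ≠ z → y ≠ z → ¬ G.Adj x y → ¬ G.Adj x z → ¬ G.Adj y z →
      G.IsDiamond b c x d → ∃ a b c a' b' c', G.IsSun a b c a' b' c' :=
    fun hxy hxz hyz nxy nxz nyz h =>
      h.exists_isSun_of_tip hclaw hmid htip hxy hxz hyz nxy nxz nyz
  have mid : ∀ {x y z b c a d}, x ≠ y → x ≠ z → y ≠ z → ¬ G.Adj x y → ¬ G.Adj x z →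
      ¬ G.Adj y z → G.IsDiamond b c a d → x ≠ b := by
    rintro x y z b c a d hxy hxz hyz nxy nxz nyz h rfl
    have h1 := hmid x c a d y h
    have h2 := hmid x c a d z h
    have := hclaw c x y z h.mid.symm (by have := comm x y; have := comm c y; tauto)
      (by have := comm x z; have := comm c z; tauto) hxy hxz hyz
    tauto
  -- A vertex of the triple not adjacent to the whole diamond is the tip of a diamond.
  have step : ∀ {x y z b c a d}, x ≠ y → x ≠ z → y ≠ z → ¬ G.Adj x y → ¬ G.Adj x z →
      ¬ G.Adj y z → G.IsDiamond b c a d →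
      (∃ a b c a' b' c', G.IsSun a b c a' b' c') ∨ (G.Adj x b ∧ G.Adj x c) := by
    intro x y z b c a d hxy hxz hyz nxy nxz nyz h
    by_contra! hn
    have T : ∀ b c d, ¬ G.IsDiamond b c x d := fun b c d h' => by
      obtain ⟨a, b, c, a', b', c', hs⟩ := tip hxy hxz hyz nxy nxz nyz h'
      exact hn.1 a b c a' b' c' hs
    have hxb := mid hxy hxz hyz nxy nxz nyz h
    have hxc := mid hxy hxz hyz nxy nxz nyz h.swap
    have hxa : x ≠ a := by rintro rfl; exact T _ _ _ h
    have hxd : x ≠ d := by rintro rfl; exact T _ _ _ h.symm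
    have h1 := hmid b c a d x h
    have h2 := htip b c a d x h
    have n := hn.2
    have hA : ¬ (G.Adj x a ∧ G.Adj x b) := fun e =>
      T a b c ⟨hxc, fun e' => n e.2 e', h.ab, e.1, e.2, h.ac.symm, h.mid.symm⟩
    have hB : ¬ (G.Adj x a ∧ G.Adj x c) := fun e =>
      T a c b ⟨hxb, fun e' => n e' e.2, h.ac, e.1, e.2, h.ab.symm, h.mid⟩
    have hC : ¬ (G.Adj x d ∧ G.Adj x b) := fun e =>
      T d b c ⟨hxc, fun e' => n e.2 e', h.db, e.1, e.2, h.dc.symm, h.mid.symm⟩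
    have hD : ¬ (G.Adj x d ∧ G.Adj x c) := fun e =>
      T d c b ⟨hxb, fun e' => n e' e.2, h.dc, e.1, e.2, h.db.symm, h.mid⟩
    tauto
  rcases step hxy hxz hyz nxy nxz nyz h with hs | hx
  · exact hs
  rcases step hxy.symm hyz hxz (fun e => nxy e.symm) nyz nxz h with hs | hy
  · exact hs
  exact tip hxy hxz hyz nxy nxz nyz ⟨hxy, nxy, h.mid, hx.1, hx.2, hy.1, hy.2⟩

theorem Finset.exists_injOn_lt_card {α : Type*} (s : Finset α) {n : ℕ} (h : s.card ≤ n) :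
    ∃ f : α → ℕ, Set.InjOn f s ∧ ∀ x ∈ s, f x < n := by
  classical
  refine ⟨fun x => if hx : x ∈ s then s.equivFin ⟨x, hx⟩ else 0, ?_, ?_⟩
  · intro x hx y hy hxy
    have hx : x ∈ s := hx
    have hy : y ∈ s := hy
    simp only [hx, hy, dif_pos] at hxy
    exact congrArg Subtype.val (s.equivFin.injective (Fin.ext hxy))
  · intro x hx
    simp only [hx, dif_pos]
    exact (Fin.is_lt _).trans_le h

theorem SimpleGraph.IsSun.colorable {V : Type*} [Finite V] {G : SimpleGraph V} {k : ℕ}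
    (hclaw : ∀ v x y z, G.Adj v x → G.Adj v y → G.Adj v z → x ≠ y → x ≠ z → y ≠ z →
      G.Adj x y ∨ G.Adj x z ∨ G.Adj y z)
    (hk : ∀ s : Finset V, G.IsClique s → s.card + 1 ≤ k)
    (hmid : ∀ b c a d x, G.IsDiamond b c a d → G.Adj x b ∨ G.Adj x c)
    (htip : ∀ b c a d x, G.IsDiamond b c a d → x = a ∨ x = d ∨ G.Adj x a ∨ G.Adj x d)
    {a b c a' b' c' : V} (h : G.IsSun a b c a' b' c') : G.Colorable k := by
  classical
  have := Fintype.ofFinite V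
  have comm := G.adj_comm
  have hnaa : ∀ {a b c a' b' c' : V}, G.IsSun a b c a' b' c' → a ≠ a' := by
    rintro a b c a' b' c' h rfl
    exact h.nab h.ab'.symm
  have dia : ∀ {a b c a' b' c' : V}, G.IsSun a b c a' b' c' → G.IsDiamond b c a a' :=
    fun h => ⟨hnaa h, fun e => h.naa e.symm, h.bc, h.ab, h.ac, h.ba', h.ca'⟩
  have ne1 : ∀ {a b c a' b' c' : V}, G.IsSun a b c a' b' c' → a' ≠ b' := by
    rintro a b c a' b' c' h rfl
    exact h.nbb h.ba'
  have dsun := dia h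
  have dsun2 := dia h.rotate
  have dsun3 := dia h.rotate.rotate
  have nab := ne1 h
  have nbc := ne1 h.rotate
  have nca := ne1 h.rotate.rotate
  -- No vertex is adjacent to the whole triangle.
  have hall : ∀ {a b c a' b' c' : V} (w : V), G.IsSun a b c a' b' c' →
      G.Adj w a → G.Adj w b → G.Adj w c → G.Adj w c' := by
    intro a b c a' b' c' w h ha hb hc
    by_contra hn
    have hwc : w ≠ c' := by rintro rfl; exact h.ncc hc
    have d1 : G.IsDiamond a b w c' := ⟨hwc, hn, h.ab, ha, hb, h.ac', h.bc'⟩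
    have h1 := htip _ _ _ _ a' d1
    have h2 := htip _ _ _ _ b' d1
    have hwa : a' ≠ w := by rintro rfl; exact h.naa ha
    have hwb : b' ≠ w := by rintro rfl; exact h.nbb hb
    have n1 := ne1 h.rotate
    have n2 := ne1 h.rotate.rotate
    have n3 := h.nac
    have n4 := h.nbc
    have d2 : G.IsDiamond w c a' b' :=
      ⟨ne1 h, h.nab, hc, by tauto, h.ca', by tauto, h.cb'⟩
    have h3 := hmid _ _ _ _ c' d2
    have := h.ncc
    have := comm w c'
    tauto
  have h3 : ∀ w, ¬ (G.Adj w a ∧ G.Adj w b ∧ G.Adj w c) := by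
    rintro w ⟨ha, hb, hc⟩
    have := hclaw w a' b' c' (hall w h.rotate hb hc ha) (hall w h.rotate.rotate hc ha hb)
      (hall w h ha hb hc) nab nca.symm nbc
    have := h.nab
    have := h.nac
    have := h.nbc
    tauto
  have hcross : ∀ {a b c a' b' c' : V} (w w' : V), G.IsSun a b c a' b' c' → w ≠ a → ¬ G.Adj w a →
      G.Adj w b → G.Adj w c → w' ≠ b → ¬ G.Adj w' b → G.Adj w' a → G.Adj w' c →
      ¬ G.Adj w w' := by
    intro a b c a' b' c' w w' h hwa nwa hwb hwc hwb' nwb ha' hc' hww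
    have d1 : G.IsDiamond w c b w' := ⟨hwb'.symm, fun e => nwb e.symm, hwc, hwb.symm, h.bc,
      hww.symm, hc'⟩
    have h1 := hmid _ _ _ _ c' d1
    have hcw : G.Adj c' w := h1.resolve_right h.ncc
    have d2 : G.IsDiamond b c' a w := ⟨hwa.symm, fun e => nwa e.symm, h.bc'.symm, h.ab,
      h.ac'.symm, hwb, hcw.symm⟩
    have h2 := hmid _ _ _ _ b' d2
    have := h.nbb
    have := h.nbc
    tauto
  have hcl : ∀ {a b c a' b' c' : V} (w w' : V), G.IsSun a b c a' b' c' → w ≠ a → ¬ G.Adj w a →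
      G.Adj w b → G.Adj w c → w' ≠ a → ¬ G.Adj w' a → G.Adj w' b → G.Adj w' c → w ≠ w' →
      G.Adj w w' := by
    intro a b c a' b' c' w w' h hwa nwa hwb hwc hwa' nwa' hwb' hwc' hne
    by_contra hn
    have := htip _ _ _ _ a ⟨hne, hn, h.bc, hwb, hwc, hwb', hwc'⟩
    have := comm a w
    have := comm a w'
    tauto
  have hcol : ∀ {a b c a' b' c' : V}, G.IsSun a b c a' b' c' → ∃ f : V → ℕ,
      ∀ w, w ≠ a → ¬ G.Adj w a → G.Adj w b → G.Adj w c → f w + 3 < k ∧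
      ∀ w', w' ≠ a → ¬ G.Adj w' a → G.Adj w' b → G.Adj w' c → G.Adj w w' → f w ≠ f w' := by
    intro a b c a' b' c' h
    let W : Finset V := Finset.univ.filter fun w =>
      w ≠ a ∧ ¬ G.Adj w a ∧ G.Adj w b ∧ G.Adj w c
    have hW := hk (insert b (insert c W)) (by
      intro u hu v hv huv
      have hbc := h.bc
      simp only [W, Finset.coe_insert, Finset.coe_filter, Finset.mem_univ, true_and,
        Set.mem_insert_iff, Set.mem_ofPred_eq] at hu hv
      rcases hu with rfl | rfl | hu <;> rcases hv with rfl | rfl | hv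
      · exact absurd rfl huv
      · exact hbc
      · exact hv.2.2.1.symm
      · exact hbc.symm
      · exact absurd rfl huv
      · exact hv.2.2.2.symm
      · exact hu.2.2.1
      · exact hu.2.2.2
      · exact hcl u v h hu.1 hu.2.1 hu.2.2.1 hu.2.2.2 hv.1 hv.2.1 hv.2.2.1 hv.2.2.2 huv)
    have hcW : c ∉ W := by simp [W]
    have hbW : b ∉ insert c W := by simp [W, h.bc.ne]
    rw [Finset.card_insert_of_notMem hbW, Finset.card_insert_of_notMem hcW] at hW
    obtain ⟨f, hf, hlt⟩ := W.exists_injOn_lt_card (n := k - 3) (by omega)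
    have hmem : ∀ w, w ≠ a → ¬ G.Adj w a → G.Adj w b → G.Adj w c → w ∈ W := by
      intro w h1 h2 h3 h4
      simp [W, h1, h2, h3, h4]
    refine ⟨f, fun w h1 h2 h3 h4 => ⟨?_, fun w' h1' h2' h3' h4' hww he => ?_⟩⟩
    · have := hlt w (hmem w h1 h2 h3 h4)
      omega
    · exact hww.ne (hf (hmem w h1 h2 h3 h4) (hmem w' h1' h2' h3' h4') he)
  obtain ⟨f, hf⟩ := hcol h
  obtain ⟨g, hg⟩ := hcol h.rotate
  obtain ⟨e, he⟩ := hcol h.rotate.rotate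
  have hk3 : 3 < k := by
    have := (hf a' (hnaa h).symm h.naa h.ba' h.ca').1
    omega
  have hcase : ∀ w, w = a ∨ w = b ∨ w = c ∨
      (w ≠ a ∧ w ≠ b ∧ w ≠ c ∧ ((¬ G.Adj w a ∧ G.Adj w b ∧ G.Adj w c) ∨
        (¬ G.Adj w b ∧ G.Adj w a ∧ G.Adj w c) ∨ (¬ G.Adj w c ∧ G.Adj w a ∧ G.Adj w b))) := by
    intro w
    have := hmid _ _ _ _ w dsun
    have := hmid _ _ _ _ w dsun2
    have := hmid _ _ _ _ w dsun3
    have := h3 w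
    tauto
  let F : V → ℕ := fun w => if ¬ G.Adj w a then f w else if ¬ G.Adj w b then g w else e w
  let C : V → ℕ := fun w =>
    if w = a then k - 1 else if w = b then k - 2 else if w = c then k - 3 else F w
  have hF : ∀ w, w ≠ a → w ≠ b → w ≠ c → F w + 3 < k := by
    intro w ha hb hc
    have := hcase w
    simp only [F]
    split_ifs with h1 h2
    · exact (he w hc (by tauto) h1 h2).1
    · exact (hg w hb h2 (by tauto) h1).1
    · exact (hf w ha h1 (by tauto) (by tauto)).1
  have hFF : ∀ w w', w ≠ a → w ≠ b → w ≠ c → w' ≠ a → w' ≠ b → w' ≠ c → G.Adj w w' →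
      F w ≠ F w' := by
    intro w w' ha hb hc ha' hb' hc' hww
    have h1 := hcase w
    have h2 := hcase w'
    simp only [ha, hb, hc, ha', hb', hc', false_or, ne_eq, not_false_eq_true, true_and] at h1 h2
    rcases h1 with h1 | h1 | h1 <;> rcases h2 with h2 | h2 | h2
    · simp only [F, h1, h2, not_false_eq_true, if_true]
      exact (hf w ha h1.1 h1.2.1 h1.2.2).2 w' ha' h2.1 h2.2.1 h2.2.2 hww
    · exact absurd hww (hcross w w' h ha h1.1 h1.2.1 h1.2.2 hb' h2.1 h2.2.1 h2.2.2)
    · exact absurd hww.symm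
        (hcross w' w h.rotate.rotate hc' h2.1 h2.2.1 h2.2.2 ha h1.1 h1.2.2 h1.2.1)
    · exact absurd hww.symm (hcross w' w h ha' h2.1 h2.2.1 h2.2.2 hb h1.1 h1.2.1 h1.2.2)
    · simp only [F, h1, h2, not_false_eq_true, not_true_eq_false, if_true, if_false]
      exact (hg w hb h1.1 h1.2.2 h1.2.1).2 w' hb' h2.1 h2.2.2 h2.2.1 hww
    · exact absurd hww
        (hcross w w' h.rotate hb h1.1 h1.2.2 h1.2.1 hc' h2.1 h2.2.2 h2.2.1)
    · exact absurd hww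
        (hcross w w' h.rotate.rotate hc h1.1 h1.2.1 h1.2.2 ha' h2.1 h2.2.2 h2.2.1)
    · exact absurd hww.symm
        (hcross w' w h.rotate hb' h2.1 h2.2.2 h2.2.1 hc h1.1 h1.2.2 h1.2.1)
    · simp only [F, h1, h2, not_true_eq_false, if_false]
      exact (he w hc h1.1 h1.2.1 h1.2.2).2 w' hc' h2.1 h2.2.1 h2.2.2 hww
  have hC : ∀ w, (w = a ∧ C w = k - 1) ∨ (w = b ∧ C w = k - 2) ∨ (w = c ∧ C w = k - 3) ∨
      (w ≠ a ∧ w ≠ b ∧ w ≠ c ∧ C w = F w ∧ F w + 3 < k) := by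
    intro w
    by_cases ha : w = a
    · exact Or.inl ⟨ha, if_pos ha⟩
    by_cases hb : w = b
    · exact Or.inr (Or.inl ⟨hb, by simp only [C, if_neg ha, if_pos hb]⟩)
    by_cases hc : w = c
    · exact Or.inr (Or.inr (Or.inl ⟨hc, by simp only [C, if_neg ha, if_neg hb, if_pos hc]⟩))
    · exact Or.inr (Or.inr (Or.inr ⟨ha, hb, hc,
        by simp only [C, if_neg ha, if_neg hb, if_neg hc], hF w ha hb hc⟩))
  refine colorable_of_nat C (fun w => ?_) fun w w' hww => ?_
  · have := hC w
    omega
  · have hne := hww.ne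
    rcases hC w with h1 | h1 | h1 | h1 <;> rcases hC w' with h2 | h2 | h2 | h2 <;>
      first
        | exact absurd (h1.1.trans h2.1.symm) hne
        | omega
        | skip
    rw [h1.2.2.2.1, h2.2.2.2.1]
    exact hFF w w' h1.1 h1.2.1 h1.2.2.1 h2.1 h2.2.1 h2.2.2.1 hww

/-- A claw-free graph in which every neighbour of a tip of a diamond sees the middle of that diamond
is `k`-colorable as soon as its cliques have fewer than `k` vertices. -/
theorem SimpleGraph.colorable_of_claw_free {V : Type*} [Finite V] {G : SimpleGraph V} {k : ℕ}
    (hclaw : ∀ v x y z, G.Adj v x → G.Adj v y → G.Adj v z → x ≠ y → x ≠ z → y ≠ z →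
      G.Adj x y ∨ G.Adj x z ∨ G.Adj y z)
    (hd : ∀ a b c d e, G.IsDiamond b c a d → G.Adj d e → G.Adj e b ∨ G.Adj e c)
    (hk : ∀ s : Finset V, G.IsClique (s : Set V) → s.card + 1 ≤ k) : G.Colorable k := by
  classical
  induction hn : Nat.card V using Nat.strong_induction_on generalizing V with
  | _ n ih =>
  have hind : ∀ S : Set V, S ≠ Set.univ → (G.induce S).Colorable k := by
    intro S hS
    refine ih (Nat.card S) ?_
      (fun v x y z hx hy hz hxy hxz hyz => hclaw v x y z hx hy hz (Subtype.coe_ne_coe.2 hxy)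
        (Subtype.coe_ne_coe.2 hxz) (Subtype.coe_ne_coe.2 hyz))
      (fun a b c d e h => hd a b c d e
        ⟨Subtype.coe_ne_coe.2 h.ne, h.not_adj, h.mid, h.ab, h.ac, h.db, h.dc⟩)
      (fun s hs => ?_) rfl
    · rw [← hn, Nat.card_coe_set_eq]
      exact Set.ncard_lt_card hS
    · rw [← Finset.card_map (Function.Embedding.subtype _)]
      refine hk _ ?_
      intro x hx y hy hxy
      simp only [Finset.coe_map, Set.mem_image] at hx hy
      obtain ⟨x, hx, rfl⟩ := hx
      obtain ⟨y, hy, rfl⟩ := hy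
      exact hs hx hy (fun h => hxy (congrArg _ h))
  by_cases hclosed : ∃ S : Set V, S.Nonempty ∧ S ≠ Set.univ ∧ ∀ x ∈ S, ∀ y, G.Adj x y → y ∈ S
  · obtain ⟨S, hS, hS', hadj⟩ := hclosed
    obtain ⟨c₁⟩ := hind S hS'
    obtain ⟨c₂⟩ := hind Sᶜ (by simpa using hS.ne_empty)
    refine ⟨Coloring.mk (fun v => if h : v ∈ S then c₁ ⟨v, h⟩ else c₂ ⟨v, h⟩) ?_⟩
    intro v w hvw
    split_ifs with h1 h2 h2
    · exact c₁.valid hvw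
    · exact absurd (hadj v h1 w hvw) h2
    · exact absurd (hadj w h2 v hvw.symm) h1
    · exact c₂.valid hvw
  have hconn : ∀ S : Set V, S.Nonempty → (∀ x ∈ S, ∀ y, G.Adj x y → y ∈ S) → ∀ x, x ∈ S := by
    intro S hS hadj x
    by_contra hx
    exact hclosed ⟨S, hS, fun h => hx (h ▸ Set.mem_univ x), hadj⟩
  have hmid : ∀ b c a d x, G.IsDiamond b c a d → G.Adj x b ∨ G.Adj x c := fun b c a d x h =>
    hconn {x | G.Adj x b ∨ G.Adj x c} ⟨b, Or.inr h.mid⟩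
      (fun _ hx _ hxy => h.adj_mid_of_adj hclaw hd hx hxy) x
  have htip : ∀ b c a d x, G.IsDiamond b c a d → x = a ∨ x = d ∨ G.Adj x a ∨ G.Adj x d :=
    fun b c a d x h => h.adj_tip_of_adj_mid hclaw (hmid b c a d x h)
  by_cases hdia : ∃ b c a d, G.IsDiamond b c a d
  · obtain ⟨b, c, a, d, h⟩ := hdia
    by_cases hα : ∃ x y z, x ≠ y ∧ x ≠ z ∧ y ≠ z ∧ ¬ G.Adj x y ∧ ¬ G.Adj x z ∧ ¬ G.Adj y z
    · obtain ⟨x, y, z, hxy, hxz, hyz, nxy, nxz, nyz⟩ := hα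
      obtain ⟨_, _, _, _, _, _, hsun⟩ := h.exists_isSun hclaw hmid htip hxy hxz hyz nxy nxz nyz
      exact hsun.colorable hclaw hk hmid htip
    · refine colorable_of_no_indep_triple hk hmid ?_ h.ne h.not_adj
      intro x y z hxy hxz hyz
      by_contra! hn
      exact hα ⟨x, y, z, hxy, hxz, hyz, hn⟩
  · cases isEmpty_or_nonempty V
    · exact Colorable.of_isEmpty k
    have := Fintype.ofFinite V
    obtain ⟨Q, hQ⟩ := G.exists_isNClique_cliqueNum
    have hmax : ∀ s : Finset V, G.IsClique (s : Set V) → s.card ≤ Q.card := fun s hs =>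
      hQ.card_eq ▸ hs.card_le_cliqueNum
    have hQne : Q.Nonempty := by
      have := hmax {Classical.arbitrary V} (by simp)
      exact Finset.card_pos.1 (by simpa using this)
    refine colorable_of_induce_compl_clique hclaw ?_ hQ.isClique hQne hmax (hk Q hQ.isClique)
      (hind _ ?_)
    · intro b c a d had hbc hab hac hdb hdc
      by_contra h
      exact hdia ⟨b, c, a, d, had, h, hbc, hab, hac, hdb, hdc⟩
    · simpa using hQne.ne_empty

theorem SimpleGraph.nonempty_embedding_of_lt {ι V : Type*} [LinearOrder ι] {H : SimpleGraph ι}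
    {G : SimpleGraph V} (f : ι → V) (hne : ∀ i j, i < j → f i ≠ f j)
    (hadj : ∀ i j, i < j → (G.Adj (f i) (f j) ↔ H.Adj i j)) : Nonempty (H ↪g G) := by
  refine ⟨⟨⟨f, fun i j hij => ?_⟩, fun {i j} => ?_⟩⟩
  · rcases lt_trichotomy i j with h | h | h
    · exact absurd hij (hne i j h)
    · exact h
    · exact absurd hij.symm (hne j i h)
  · change G.Adj (f i) (f j) ↔ H.Adj i j
    rcases lt_trichotomy i j with h | rfl | h
    · exact hadj i j h
    · simp
    · rw [G.adj_comm, H.adj_comm]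
      exact hadj j i h

theorem SimpleGraph.nonempty_claw_embedding {V : Type*} {G : SimpleGraph V} {v x y z : V}
    (hx : G.Adj v x) (hy : G.Adj v y) (hz : G.Adj v z) (hxy : x ≠ y) (hxz : x ≠ z) (hyz : y ≠ z)
    (nxy : ¬ G.Adj x y) (nxz : ¬ G.Adj x z) (nyz : ¬ G.Adj y z) : Nonempty (claw ↪g G) := by
  have nyx := mt Adj.symm nxy
  have nzx := mt Adj.symm nxz
  have nzy := mt Adj.symm nyz
  have hleaf : Function.Injective ![x, y, z] := by
    intro i j hij
    fin_cases i <;> fin_cases j <;> simp_all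
  have hadj : ∀ i, G.Adj v (![x, y, z] i) := by
    intro i
    fin_cases i <;> assumption
  have hnadj : ∀ i j, ¬ G.Adj (![x, y, z] i) (![x, y, z] j) := by
    intro i j
    fin_cases i <;> fin_cases j <;> simp [nxy, nxz, nyz, nyx, nzx, nzy]
  refine ⟨⟨⟨Sum.elim (fun _ => v) ![x, y, z], ?_⟩, fun {i j} => ?_⟩⟩
  · rintro (i | i) (j | j) hij
    · rw [Subsingleton.elim i j]
    · exact absurd hij (hadj j).ne
    · exact absurd hij (hadj i).ne'
    · exact congrArg Sum.inr (hleaf hij)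
  · change G.Adj (Sum.elim (fun _ => v) ![x, y, z] i) (Sum.elim (fun _ => v) ![x, y, z] j) ↔ _
    rcases i with i | i <;> rcases j with j | j <;>
      simp only [claw, completeBipartiteGraph_adj, Sum.elim_inl, Sum.elim_inr]
    · simp
    · simpa using hadj j
    · simpa using (hadj i).symm
    · simpa using hnadj i j

theorem SimpleGraph.IsDiamond.adj_mid_of_adj_tip {V : Type*} {G : SimpleGraph V}
    (h1 : ¬ Nonempty (H1 ↪g G)) (h2 : ¬ Nonempty (H2 ↪g G)) {a b c d e : V}
    (h : G.IsDiamond b c a d) (hde : G.Adj d e) : G.Adj e b ∨ G.Adj e c := by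
  by_contra! hn
  obtain ⟨neb, nec⟩ := hn
  have nbe := mt Adj.symm neb
  have nce := mt Adj.symm nec
  have hae : a ≠ e := by rintro rfl; exact neb h.ab
  have hbe : b ≠ e := by rintro rfl; exact nec h.mid
  have hce : c ≠ e := by rintro rfl; exact neb h.mid.symm
  have hne : ∀ i j : Fin 5, i < j → ![a, b, c, d, e] i ≠ ![a, b, c, d, e] j := by
    intro i j hij
    fin_cases i <;> fin_cases j <;> first
      | exact absurd hij (by decide)
      | simp [h.ne, h.mid.ne, h.ab.ne, h.ac.ne, h.db.ne', h.dc.ne', hde.ne, hae, hbe, hce]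
  by_cases hae : G.Adj a e
  · refine h2 (nonempty_embedding_of_lt _ hne fun i j hij => ?_)
    fin_cases i <;> fin_cases j <;> first
      | exact absurd hij (by decide)
      | simp [H2, h.not_adj, h.mid, h.ab, h.ac, h.db.symm, h.dc.symm, hde, hae, nbe, nce]
  · refine h1 (nonempty_embedding_of_lt _ hne fun i j hij => ?_)
    fin_cases i <;> fin_cases j <;> first
      | exact absurd hij (by decide)
      | simp [H1, h.not_adj, h.mid, h.ab, h.ac, h.db.symm, h.dc.symm, hde, hae, nbe, nce]

theorem stmt_10 {V : Type*} [Fintype V] (G : SimpleGraph V)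
    (hclaw : ¬ Nonempty (claw ↪g G)) (h1 : ¬ Nonempty (H1 ↪g G))
    (h2 : ¬ Nonempty (H2 ↪g G)) :
    G.chromaticNumber ≤ (G.cliqueNum : ℕ∞) + 1 := by
  have hcol : G.Colorable (G.cliqueNum + 1) := by
    refine colorable_of_claw_free (fun v x y z hx hy hz hxy hxz hyz => ?_)
      (fun _ _ _ _ _ h => h.adj_mid_of_adj_tip h1 h2)
      fun s hs => Nat.succ_le_succ hs.card_le_cliqueNum
    by_contra! h
    exact hclaw (nonempty_claw_embedding hx hy hz hxy hxz hyz h.1 h.2.1 h.2.2)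
  exact_mod_cast hcol.chromaticNumber_le
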